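/- Let n ≥ 1 and let A be an n×n complex matrix. Then there exist ℓ ≥ 1 and n×n complex matrices A₁, …, A_ℓ with A₁ = A and B(A_i) ≠ B(A_j) for i ≠ j, such that closure(B(A)) = B(A₁) ∪ ⋯ ∪ B(A_ℓ), and moreover closure(B(A_i)) is strictly contained in closure(B(A)) for every i ≠ 1. -/

import Mathlib

/-- The bundle (under similarity) of an `n × n` complex matrix `A`: the set of matrices `M`
for which there is a bijection `φ : ℂ → ℂ` such that
`rank((M - φ(μ)·I)^k) = rank((A - μ·I)^k)` for all `μ ∈ ℂ` and all `k ∈ ℕ`. -/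
def matrixBundle {n : ℕ} (A : Matrix (Fin n) (Fin n) ℂ) : Set (Matrix (Fin n) (Fin n) ℂ) :=
  {M | ∃ φ : ℂ ≃ ℂ, ∀ (μ : ℂ) (k : ℕ),
    ((M - φ μ • (1 : Matrix (Fin n) (Fin n) ℂ)) ^ k).rank
      = ((A - μ • (1 : Matrix (Fin n) (Fin n) ℂ)) ^ k).rank}

open Polynomial in
theorem finrank_torsionBy_congr {K V W : Type*} [Field K]
    [AddCommGroup V] [Module K V] [Module K[X] V] [IsScalarTower K K[X] V]
    [AddCommGroup W] [Module K W] [Module K[X] W] [IsScalarTower K K[X] W]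
    (e : V ≃ₗ[K[X]] W) (a : K[X]) :
    Module.finrank K (Submodule.torsionBy K[X] V a) =
      Module.finrank K (Submodule.torsionBy K[X] W a) := by
  have h : (Submodule.torsionBy K[X] V a).map (e : V →ₗ[K[X]] W) =
      Submodule.torsionBy K[X] W a := by
    ext x
    simp only [Submodule.mem_map, Submodule.mem_torsionBy_iff]
    constructor
    · rintro ⟨y, hy, rfl⟩
      simp [← map_smul, hy]
    · intro hx
      exact ⟨e.symm x, by rw [← map_smul, hx, map_zero], by simp⟩
  exact ((e.ofSubmodules _ _ h).restrictScalars K).finrank_eq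

open Polynomial in
theorem finrank_torsionBy_pi {K ι : Type*} [Field K] [Fintype ι] (V : ι → Type*)
    [∀ i, AddCommGroup (V i)] [∀ i, Module K (V i)] [∀ i, Module K[X] (V i)]
    [∀ i, IsScalarTower K K[X] (V i)] [∀ i, FiniteDimensional K (V i)] (a : K[X]) :
    Module.finrank K (Submodule.torsionBy K[X] (∀ i, V i) a) =
      ∑ i, Module.finrank K (Submodule.torsionBy K[X] (V i) a) := by
  have hfin (i : ι) : FiniteDimensional K (Submodule.torsionBy K[X] (V i) a) :=
    inferInstanceAs (FiniteDimensional K ((Submodule.torsionBy K[X] (V i) a).restrictScalars K))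
  rw [← Module.finrank_pi_fintype K]
  refine LinearEquiv.finrank_eq
    { toFun := fun x i => ⟨x.1 i, ?_⟩
      invFun := fun x => ⟨fun i => (x i).1, ?_⟩
      map_add' := fun _ _ => rfl
      map_smul' := fun _ _ => rfl
      left_inv := fun _ => rfl
      right_inv := fun _ => rfl }
  · have := (Submodule.mem_torsionBy_iff _ _).1 x.2
    exact (Submodule.mem_torsionBy_iff _ _).2 (congrFun this i)
  · refine (Submodule.mem_torsionBy_iff _ _).2 (funext fun i => ?_)
    exact (Submodule.mem_torsionBy_iff _ _).1 (x i).2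

open Polynomial in
theorem finrank_torsionBy_quotient {K : Type*} [Field K] [DecidableEq K] (μ ν : K) (k e : ℕ) :
    Module.finrank K (Submodule.torsionBy K[X]
      (K[X] ⧸ Submodule.span K[X] {(X - C ν) ^ e}) ((X - C μ) ^ k)) =
      if ν = μ then min k e else 0 := by
  have hfin : FiniteDimensional K (K[X] ⧸ Submodule.span K[X] {(X - C ν) ^ e}) :=
    ((monic_X_sub_C ν).pow e).finite_quotient
  have hdim (c : ℕ) : Module.finrank K (K[X] ⧸ Submodule.span K[X] {(X - C ν) ^ c}) = c := by
    have := finrank_quotient_span_eq_natDegree (K := K) (f := (X - C ν) ^ c)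
    simpa using this
  set V := K[X] ⧸ Submodule.span K[X] {(X - C ν) ^ e} with hV
  let f : V →ₗ[K[X]] V := LinearMap.lsmul K[X] V ((X - C μ) ^ k)
  let g : K[X] →ₗ[K[X]] V := f ∘ₗ Submodule.mkQ (Submodule.span K[X] {(X - C ν) ^ e})
  have hg : LinearMap.ker g =
      Submodule.span K[X] {(X - C ν) ^ (if ν = μ then e - k else e)} := by
    ext x
    have h1 : x ∈ LinearMap.ker g ↔ (X - C ν) ^ e ∣ (X - C μ) ^ k * x := by
      rw [← Ideal.mem_span_singleton]
      change (X - C μ) ^ k • (Submodule.Quotient.mk x : V) = 0 ↔ _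
      rw [← Submodule.Quotient.mk_smul, Submodule.Quotient.mk_eq_zero]
      rfl
    have h2 : x ∈ Submodule.span K[X] {(X - C ν) ^ (if ν = μ then e - k else e)} ↔
      (X - C ν) ^ (if ν = μ then e - k else e) ∣ x := Ideal.mem_span_singleton
    rw [h1, h2]
    split_ifs with h
    · subst h
      rcases le_total k e with hk | hk
      · obtain ⟨d, rfl⟩ := Nat.exists_eq_add_of_le hk
        rw [pow_add, mul_dvd_mul_iff_left (pow_ne_zero _ (X_sub_C_ne_zero ν))]
        simp
      · simp only [Nat.sub_eq_zero_of_le hk, pow_zero, one_dvd, iff_true]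
        exact (pow_dvd_pow _ hk).mul_right _
    · have hc : IsCoprime ((X - C ν) ^ e) ((X - C μ) ^ k) :=
        (isCoprime_X_sub_C_of_isUnit_sub (sub_ne_zero.2 h).isUnit).pow
      exact ⟨fun H => hc.dvd_of_dvd_mul_left H, fun H => H.mul_left _⟩
  have hr : LinearMap.range g = LinearMap.range f := by
    rw [LinearMap.range_comp, Submodule.range_mkQ, Submodule.map_top]
  have h1 : Module.finrank K (LinearMap.range f) = if ν = μ then e - k else e := by
    rw [← hr, ← (g.quotKerEquivRange.restrictScalars K).finrank_eq, hg, hdim]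
  have h2 := LinearMap.finrank_range_add_finrank_ker (f.restrictScalars K)
  have h3 : (if ν = μ then e - k else e) +
      Module.finrank K (Submodule.torsionBy K[X] V ((X - C μ) ^ k)) = e := by
    rw [← h1]
    exact h2.trans (hdim e)
  change Module.finrank K (Submodule.torsionBy K[X] V ((X - C μ) ^ k)) = _
  generalize Module.finrank K (Submodule.torsionBy K[X] V ((X - C μ) ^ k)) = d at h3 ⊢
  split_ifs at h3 ⊢ <;> omega

open Polynomial in
theorem exists_equiv_pi_quotient {K : Type} {V : Type} [Field K] [IsAlgClosed K] [AddCommGroup V]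
    [Module K[X] V] [Module.Finite K[X] V] (hV : Module.IsTorsion K[X] V) :
    ∃ (ι : Type) (_ : Fintype ι) (ν : ι → K) (e : ι → ℕ), (∀ i, 0 < e i) ∧
      Nonempty (V ≃ₗ[K[X]] ∀ i, K[X] ⧸ Submodule.span K[X] {(X - C (ν i)) ^ e i}) := by
  classical
  obtain ⟨ι, _, p, hp, e, ⟨E⟩⟩ := Module.equiv_directSum_of_isTorsion hV
  have hroot (i : ι) : ∃ ν : K, Associated (p i) (X - C ν) := by
    obtain ⟨ν, hν⟩ := IsAlgClosed.exists_root (p i)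
      (by rw [IsAlgClosed.degree_eq_one_of_irreducible K (hp i)]; simp)
    exact ⟨ν, ((irreducible_X_sub_C ν).associated_of_dvd (hp i) (dvd_iff_isRoot.2 hν)).symm⟩
  choose ν hν using hroot
  have hs (i : ι) : Submodule.span K[X] {p i ^ e i} = Submodule.span K[X] {(X - C (ν i)) ^ e i} :=
    Ideal.span_singleton_eq_span_singleton.2 ((hν i).pow_pow)
  let Q : ι → Type := fun i => K[X] ⧸ Submodule.span K[X] {(X - C (ν i)) ^ e i}
  let E2 : V ≃ₗ[K[X]] ∀ i, Q i :=
    (E.trans (DirectSum.linearEquivFunOnFintype _ _ _)).trans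
      (LinearEquiv.piCongrRight fun i => Submodule.quotEquivOfEq _ _ (hs i))
  let F : (∀ i, Q i) →ₗ[K[X]] ∀ i : {i // 0 < e i}, Q i.1 :=
    LinearMap.pi fun i => LinearMap.proj i.1
  have h0 (i : ι) (hi : ¬ 0 < e i) : Subsingleton (Q i) := by
    have : e i = 0 := by omega
    simp only [Q, this, pow_zero]
    exact Submodule.Quotient.subsingleton_iff.2 Ideal.span_singleton_one
  have hF : Function.Bijective F := by
    constructor
    · intro x y h
      ext1 i
      by_cases hi : 0 < e i
      · exact congrFun h ⟨i, hi⟩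
      · exact (h0 i hi).elim _ _
    · intro y
      refine ⟨fun i => if hi : 0 < e i then y ⟨i, hi⟩ else 0, ?_⟩
      ext1 i
      simp [F, i.2]
  exact ⟨{i // 0 < e i}, inferInstance, fun i => ν i, fun i => e i, fun i => i.2,
    ⟨E2.trans (LinearEquiv.ofBijective F hF)⟩⟩

theorem card_fiber_add_sum_min {K ι : Type*} [DecidableEq K] [Fintype ι] (ν : ι → K) (e : ι → ℕ)
    (μ : K) (c : ℕ) :
    Fintype.card {i // (ν i, e i) = (μ, c + 1)} + ((∑ i, if ν i = μ then min c (e i) else 0) +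
      ∑ i, if ν i = μ then min (c + 2) (e i) else 0) =
      2 * ∑ i, if ν i = μ then min (c + 1) (e i) else 0 := by
  rw [Fintype.card_subtype, Finset.card_filter, ← Finset.sum_add_distrib, ← Finset.sum_add_distrib,
    Finset.mul_sum]
  refine Finset.sum_congr rfl fun i _ => ?_
  by_cases h : ν i = μ
  · simp only [Prod.mk.injEq, h, true_and, if_true]
    split_ifs <;> omega
  · simp [h]

theorem exists_equiv_of_card_fiber_eq {α β γ : Type*} [Fintype α] [Fintype β] [DecidableEq γ]
    (f : α → γ) (g : β → γ)
    (h : ∀ c, Fintype.card {a // f a = c} = Fintype.card {b // g b = c}) :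
    ∃ e : α ≃ β, ∀ a, g (e a) = f a :=
  ⟨Equiv.ofFiberEquiv fun c => Fintype.equivOfCardEq (h c), fun a => Equiv.ofFiberEquiv_map _ a⟩

open Polynomial in
theorem nonempty_linearEquiv_of_finrank_torsionBy_eq {K : Type} {V W : Type} [Field K]
    [IsAlgClosed K]
    [AddCommGroup V] [Module K V] [Module K[X] V] [IsScalarTower K K[X] V] [Module.Finite K[X] V]
    [AddCommGroup W] [Module K W] [Module K[X] W] [IsScalarTower K K[X] W] [Module.Finite K[X] W]
    (hV : Module.IsTorsion K[X] V) (hW : Module.IsTorsion K[X] W)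
    (h : ∀ (μ : K) (k : ℕ), Module.finrank K (Submodule.torsionBy K[X] V ((X - C μ) ^ k)) =
      Module.finrank K (Submodule.torsionBy K[X] W ((X - C μ) ^ k))) :
    Nonempty (V ≃ₗ[K[X]] W) := by
  classical
  obtain ⟨ι, _, ν, e, he, ⟨E⟩⟩ := exists_equiv_pi_quotient hV
  obtain ⟨κ, _, ν', e', he', ⟨E'⟩⟩ := exists_equiv_pi_quotient hW
  have key {ι : Type} [Fintype ι] (ν : ι → K) (e : ι → ℕ) (μ : K) (k : ℕ) :
      Module.finrank K (Submodule.torsionBy K[X]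
        (∀ i, K[X] ⧸ Submodule.span K[X] {(X - C (ν i)) ^ e i}) ((X - C μ) ^ k)) =
      ∑ i, if ν i = μ then min k (e i) else 0 := by
    have hfin (i : ι) : FiniteDimensional K (K[X] ⧸ Submodule.span K[X] {(X - C (ν i)) ^ e i}) :=
      ((monic_X_sub_C (ν i)).pow (e i)).finite_quotient
    rw [finrank_torsionBy_pi]
    exact Finset.sum_congr rfl fun i _ => finrank_torsionBy_quotient _ _ _ _
  have hd (μ : K) (k : ℕ) : (∑ i, if ν i = μ then min k (e i) else 0) =
      ∑ i, if ν' i = μ then min k (e' i) else 0 := by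
    rw [← key, ← key, ← finrank_torsionBy_congr E, ← finrank_torsionBy_congr E', h]
  obtain ⟨σ, hσ⟩ := exists_equiv_of_card_fiber_eq (fun i => (ν i, e i)) (fun i => (ν' i, e' i)) (by
    rintro ⟨μ, c⟩
    cases c with
    | zero =>
      have h1 : IsEmpty {i // (ν i, e i) = (μ, 0)} :=
        ⟨fun i => (he i.1).ne' (congrArg Prod.snd i.2)⟩
      have h2 : IsEmpty {i // (ν' i, e' i) = (μ, 0)} :=
        ⟨fun i => (he' i.1).ne' (congrArg Prod.snd i.2)⟩
      rw [Fintype.card_eq_zero, Fintype.card_eq_zero]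
    | succ c =>
      have h1 := card_fiber_add_sum_min ν e μ c
      have h2 := card_fiber_add_sum_min ν' e' μ c
      simp only [hd] at h1
      omega)
  have hν (i : ι) : ν' (σ i) = ν i := congrArg Prod.fst (hσ i)
  have he (i : ι) : e' (σ i) = e i := congrArg Prod.snd (hσ i)
  let F : (∀ j, K[X] ⧸ Submodule.span K[X] {(X - C (ν' j)) ^ e' j}) ≃ₗ[K[X]]
      ∀ i, K[X] ⧸ Submodule.span K[X] {(X - C (ν i)) ^ e i} :=
    (LinearEquiv.piCongrLeft K[X]
      (fun j => K[X] ⧸ Submodule.span K[X] {(X - C (ν' j)) ^ e' j}) σ).symm.trans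
      (LinearEquiv.piCongrRight fun i => Submodule.quotEquivOfEq _ _ (by rw [hν, he]))
  exact ⟨E.trans (F.symm.trans E'.symm)⟩

theorem finrank_ker_toLin'_add_rank {n : ℕ} {K : Type*} [Field K] (A : Matrix (Fin n) (Fin n) K) :
    Module.finrank K (LinearMap.ker (Matrix.toLin' A)) + A.rank = n := by
  have := LinearMap.finrank_range_add_finrank_ker (Matrix.toLin' A)
  rw [Module.finrank_fin_fun] at this
  rw [add_comm]
  exact this

open Polynomial in
theorem finrank_torsionBy_AEval' {n : ℕ} {K : Type*} [Field K] (A : Matrix (Fin n) (Fin n) K)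
    (μ : K) (k : ℕ) :
    Module.finrank K (Submodule.torsionBy K[X] (Module.AEval' (Matrix.toLin' A))
      ((X - C μ) ^ k)) = n - ((A - μ • (1 : Matrix (Fin n) (Fin n) K)) ^ k).rank := by
  have h := finrank_ker_toLin'_add_rank ((A - μ • (1 : Matrix (Fin n) (Fin n) K)) ^ k)
  rw [← Nat.eq_sub_of_add_eq h]
  have hk : Matrix.toLin' ((A - μ • (1 : Matrix (Fin n) (Fin n) K)) ^ k) =
      aeval (Matrix.toLin' A) ((X - C μ) ^ k) := by
    rw [Matrix.toLin'_pow]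
    simp [Module.algebraMap_end_eq_smul_id]
  rw [hk]
  refine LinearEquiv.finrank_eq
    { toFun := fun x => ⟨(Module.AEval'.of (Matrix.toLin' A)).symm x.1, ?_⟩
      invFun := fun x => ⟨Module.AEval'.of (Matrix.toLin' A) x.1, ?_⟩
      map_add' := fun _ _ => rfl
      map_smul' := fun _ _ => rfl
      left_inv := fun _ => rfl
      right_inv := fun _ => rfl }
  · exact (Submodule.mem_torsionBy_iff _ _).1 x.2
  · exact (Submodule.mem_torsionBy_iff _ _).2 x.2

open Polynomial in
/-- Two matrices over an algebraically closed field whose shifted powers have equal ranks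
are similar. -/
theorem exists_conj_of_rank_eq {n : ℕ} {K : Type} [Field K] [IsAlgClosed K]
    {A B : Matrix (Fin n) (Fin n) K}
    (h : ∀ (μ : K) (k : ℕ), ((A - μ • (1 : Matrix (Fin n) (Fin n) K)) ^ k).rank =
      ((B - μ • (1 : Matrix (Fin n) (Fin n) K)) ^ k).rank) :
    ∃ P Q : Matrix (Fin n) (Fin n) K, Q * P = 1 ∧ P * Q = 1 ∧ B = P * A * Q := by
  obtain ⟨E⟩ := nonempty_linearEquiv_of_finrank_torsionBy_eq (K := K)
    (V := Module.AEval' (Matrix.toLin' A)) (W := Module.AEval' (Matrix.toLin' B))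
    (Module.AEval.isTorsion_of_finiteDimensional _ _ _)
    (Module.AEval.isTorsion_of_finiteDimensional _ _ _)
    (fun μ k => by rw [finrank_torsionBy_AEval', finrank_torsionBy_AEval', h])
  let G : (Fin n → K) ≃ₗ[K] (Fin n → K) :=
    ((Module.AEval'.of (Matrix.toLin' A)).trans (E.restrictScalars K)).trans
      (Module.AEval'.of (Matrix.toLin' B)).symm
  have hG (v : Fin n → K) : G (Matrix.toLin' A v) = Matrix.toLin' B (G v) := by
    change (Module.AEval'.of (Matrix.toLin' B)).symm
      (E (Module.AEval'.of (Matrix.toLin' A) (Matrix.toLin' A v))) = _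
    rw [← Module.AEval'.X_smul_of, map_smul, Module.AEval'.of_symm_X_smul]
    rfl
  refine ⟨LinearMap.toMatrix' G, LinearMap.toMatrix' G.symm, ?_, ?_, ?_⟩
  · rw [← LinearMap.toMatrix'_comp]; simp
  · rw [← LinearMap.toMatrix'_comp]; simp
  · apply Matrix.toLin'.injective
    rw [Matrix.toLin'_mul, Matrix.toLin'_mul, Matrix.toLin'_toMatrix', Matrix.toLin'_toMatrix']
    ext1 v
    ext1
    simp only [LinearMap.comp_apply, LinearEquiv.coe_coe]
    rw [hG]
    simp

theorem rank_pow_eq_of_le {n : ℕ} {K : Type*} [Field K] (A : Matrix (Fin n) (Fin n) K) {k : ℕ}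
    (hk : n ≤ k) : (A ^ k).rank = (A ^ n).rank := by
  have h := Module.End.ker_pow_eq_ker_pow_finrank_of_le (f := Matrix.toLin' A) (m := k)
    (by simpa using hk)
  have h1 := finrank_ker_toLin'_add_rank (A ^ k)
  have h2 := finrank_ker_toLin'_add_rank (A ^ n)
  rw [Matrix.toLin'_pow] at h1 h2
  rw [h, Module.finrank_fin_fun] at h1
  omega

theorem rank_eq_iff_isUnit {n : ℕ} {K : Type*} [Field K] (A : Matrix (Fin n) (Fin n) K) :
    A.rank = n ↔ IsUnit A := by
  constructor
  · intro h
    have h1 := finrank_ker_toLin'_add_rank A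
    have h2 : LinearMap.ker (Matrix.toLin' A) = ⊥ := Submodule.finrank_eq_zero.1 (by omega)
    have := (LinearMap.isUnit_iff_ker_eq_bot _).2 h2
    exact Matrix.isUnit_toLin'_iff.1 this
  · intro h
    simpa using Matrix.rank_of_isUnit A h

theorem notMem_spectrum_iff_rank {n : ℕ} {K : Type*} [Field K] {A : Matrix (Fin n) (Fin n) K}
    {μ : K} : μ ∉ spectrum K A ↔ ((A - μ • (1 : Matrix (Fin n) (Fin n) K)) ^ 1).rank = n := by
  rw [pow_one, rank_eq_iff_isUnit, spectrum.notMem_iff, Algebra.algebraMap_eq_smul_one,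
    ← neg_sub, IsUnit.neg_iff]

theorem rank_pow_of_notMem_spectrum {n : ℕ} {K : Type*} [Field K] {A : Matrix (Fin n) (Fin n) K}
    {μ : K} (h : μ ∉ spectrum K A) (k : ℕ) :
    ((A - μ • (1 : Matrix (Fin n) (Fin n) K)) ^ k).rank = n := by
  rw [rank_eq_iff_isUnit]
  rw [notMem_spectrum_iff_rank, rank_eq_iff_isUnit, pow_one] at h
  exact h.pow k

theorem mem_matrixBundle_self {n : ℕ} (A : Matrix (Fin n) (Fin n) ℂ) : A ∈ matrixBundle A :=
  ⟨Equiv.refl ℂ, fun _ _ => rfl⟩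

theorem matrixBundle_eq_of_mem {n : ℕ} {A M : Matrix (Fin n) (Fin n) ℂ}
    (h : M ∈ matrixBundle A) : matrixBundle M = matrixBundle A := by
  obtain ⟨φ, hφ⟩ := h
  ext X
  constructor
  · rintro ⟨ψ, hψ⟩
    exact ⟨φ.trans ψ, fun μ k => (hψ (φ μ) k).trans (hφ μ k)⟩
  · rintro ⟨ψ, hψ⟩
    refine ⟨φ.symm.trans ψ, fun μ k => ?_⟩
    have := hφ (φ.symm μ) k
    rw [φ.apply_symm_apply] at this
    exact (hψ (φ.symm μ) k).trans this.symm

/-- A bijection of spectra preserving the ranks of the first `n` powers of the shifted matrices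
witnesses membership in the bundle. -/
theorem mem_matrixBundle_of_equiv {n : ℕ} {A M : Matrix (Fin n) (Fin n) ℂ}
    (e : spectrum ℂ A ≃ spectrum ℂ M)
    (h : ∀ (μ : spectrum ℂ A) (k : ℕ), k ≤ n →
      ((M - (e μ : ℂ) • (1 : Matrix (Fin n) (Fin n) ℂ)) ^ k).rank =
        ((A - (μ : ℂ) • (1 : Matrix (Fin n) (Fin n) ℂ)) ^ k).rank) :
    M ∈ matrixBundle A := by
  have hcard : Cardinal.mk (spectrum ℂ A) < Cardinal.mk ℂ :=
    (Cardinal.lt_aleph0_iff_set_finite.2 (Matrix.finite_spectrum A)).trans_le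
      (Cardinal.aleph0_le_mk ℂ)
  obtain ⟨φ, hφ⟩ := Cardinal.extend_function_of_lt
    (e.toEmbedding.trans (Function.Embedding.subtype _)) hcard ⟨Equiv.refl ℂ⟩
  have hφ' (μ : spectrum ℂ A) : φ μ = e μ := hφ μ
  refine ⟨φ, fun μ k => ?_⟩
  by_cases hμ : μ ∈ spectrum ℂ A
  · have hk' (k : ℕ) (hk : k ≤ n) := h ⟨μ, hμ⟩ k hk
    rw [hφ' ⟨μ, hμ⟩]
    rcases le_total k n with hk | hk
    · exact hk' k hk
    · rw [rank_pow_eq_of_le _ hk, rank_pow_eq_of_le _ hk]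
      exact hk' n le_rfl
  · have hM : φ μ ∉ spectrum ℂ M := fun hM => by
      have h1 : φ (e.symm ⟨φ μ, hM⟩) = φ μ := by rw [hφ']; simp
      exact hμ (φ.injective h1 ▸ (e.symm ⟨φ μ, hM⟩).2)
    rw [rank_pow_of_notMem_spectrum hμ, rank_pow_of_notMem_spectrum hM]

theorem card_spectrum_le {n : ℕ} {K : Type*} [Field K] (A : Matrix (Fin n) (Fin n) K)
    [Fintype (spectrum K A)] : Fintype.card (spectrum K A) ≤ n := by
  classical
  have h : (spectrum K A).toFinset ⊆ A.charpoly.roots.toFinset := fun μ hμ => by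
    rw [Set.mem_toFinset, Matrix.mem_spectrum_iff_isRoot_charpoly] at hμ
    simpa [A.charpoly_monic.ne_zero] using hμ
  rw [← Set.toFinset_card]
  calc (spectrum K A).toFinset.card ≤ A.charpoly.roots.toFinset.card := Finset.card_le_card h
    _ ≤ A.charpoly.roots.card := Multiset.toFinset_card_le _
    _ ≤ A.charpoly.natDegree := Polynomial.card_roots' _
    _ = n := by rw [A.charpoly_natDegree_eq_dim, Fintype.card_fin]

open scoped Classical in
/-- There are finitely many bundles of `n × n` matrices. -/
theorem finite_range_matrixBundle (n : ℕ) :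
    (Set.range (matrixBundle : Matrix (Fin n) (Fin n) ℂ → Set _)).Finite := by
  have hfin (A : Matrix (Fin n) (Fin n) ℂ) : Fintype (spectrum ℂ A) :=
    (Matrix.finite_spectrum A).fintype
  let p (A : Matrix (Fin n) (Fin n) ℂ) (μ : spectrum ℂ A) : Fin (n + 1) → Fin (n + 1) := fun k =>
    ⟨((A - (μ : ℂ) • (1 : Matrix (Fin n) (Fin n) ℂ)) ^ (k : ℕ)).rank,
      Nat.lt_succ_of_le (by simpa using Matrix.rank_le_width _)⟩
  let c (A : Matrix (Fin n) (Fin n) ℂ) (q : Fin (n + 1) → Fin (n + 1)) : Fin (n + 1) :=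
    ⟨Fintype.card {μ // p A μ = q}, by
      have h1 := Fintype.card_subtype_le (fun μ => p A μ = q)
      have h2 : Fintype.card (spectrum ℂ A) ≤ n := card_spectrum_le A
      omega⟩
  have hc (A M : Matrix (Fin n) (Fin n) ℂ) (h : c A = c M) :
      matrixBundle M = matrixBundle A := by
    obtain ⟨e, he⟩ := exists_equiv_of_card_fiber_eq (p A) (p M)
      (fun q => congrArg Fin.val (congrFun h q))
    refine matrixBundle_eq_of_mem (mem_matrixBundle_of_equiv e fun μ k hk => ?_)
    exact congrArg Fin.val (congrFun (he μ) ⟨k, Nat.lt_succ_of_le hk⟩)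
  have hf : (Set.range fun A => c A).Finite := Set.toFinite _
  refine (hf.image (fun q => matrixBundle (Function.invFun c q))).subset ?_
  rintro _ ⟨A, rfl⟩
  exact ⟨c A, ⟨A, rfl⟩, hc _ _ (Function.invFun_eq ⟨A, rfl⟩).symm⟩

open Topology Filter

theorem isOpen_setOf_le_rank_matrix (n r : ℕ) :
    IsOpen {A : Matrix (Fin n) (Fin n) ℂ | r ≤ A.rank} := by
  let f : Matrix (Fin n) (Fin n) ℂ →ₗ[ℂ] ((Fin n → ℂ) →L[ℂ] (Fin n → ℂ)) :=
    (LinearMap.toContinuousLinearMap.toLinearMap) ∘ₗ (Matrix.toLin' : _ ≃ₗ[ℂ] _).toLinearMap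
  have hf : Continuous f := f.continuous_of_finiteDimensional
  convert! (isOpen_setOfPred_nat_le_rank (𝕜 := ℂ) (E := Fin n → ℂ) (F := Fin n → ℂ) r).preimage hf
    using 1
  ext A
  have : ((f A : (Fin n → ℂ) →L[ℂ] (Fin n → ℂ)) : (Fin n → ℂ) →ₗ[ℂ] (Fin n → ℂ)) =
    Matrix.toLin' A := rfl
  simp only [Set.mem_ofPred_eq, Set.mem_preimage, this]
  rw [LinearMap.rank, ← Module.finrank_eq_rank, Nat.cast_le]
  rfl

theorem continuous_charpoly_eval (n : ℕ) :
    Continuous fun p : Matrix (Fin n) (Fin n) ℂ × ℂ => p.1.charpoly.eval p.2 := by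
  simp only [Matrix.eval_charpoly]
  exact ((continuous_pi fun _ => continuous_snd).matrix_diagonal.sub continuous_fst).matrix_det

/-- Every eigenvalue of `M` is approached by eigenvalues of the matrices near `M`. -/
theorem eventually_exists_mem_spectrum {n : ℕ} {M : Matrix (Fin n) (Fin n) ℂ} {μ : ℂ}
    (hμ : μ ∈ spectrum ℂ M) {P : Matrix (Fin n) (Fin n) ℂ × ℂ → Prop}
    (hP : ∀ᶠ p in 𝓝 (M, μ), P p) :
    ∀ᶠ X in 𝓝 M, ∃ z ∈ spectrum ℂ X, P (X, z) := by
  rw [nhds_prod_eq] at hP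
  obtain ⟨pa, hpa, pb, hpb, H⟩ := eventually_prod_iff.1 hP
  obtain ⟨ε, hε, hball⟩ := Metric.eventually_nhds_iff.1 hpb
  have hc : Tendsto (fun X : Matrix (Fin n) (Fin n) ℂ => ‖X.charpoly.eval μ‖) (𝓝 M) (𝓝 0) := by
    have h0 : M.charpoly.eval μ = 0 := Matrix.mem_spectrum_iff_isRoot_charpoly.1 hμ
    have := ((continuous_charpoly_eval n).comp
      (Continuous.prodMk continuous_id (continuous_const (y := μ)))).norm.tendsto M
    simpa [h0] using this
  filter_upwards [hpa, hc.eventually (gt_mem_nhds (pow_pos hε n))] with X hX hlt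
  by_contra! hcon
  refine hlt.not_ge ?_
  have hs := IsAlgClosed.splits X.charpoly
  have hcard : X.charpoly.roots.card = n := by
    rw [← hs.natDegree_eq_card_roots, X.charpoly_natDegree_eq_dim, Fintype.card_fin]
  rw [hs.eval_eq_prod_roots_of_monic X.charpoly_monic]
  have hroot : ∀ z ∈ X.charpoly.roots, ε ≤ ‖μ - z‖ := fun z hz => by
    by_contra! hlt'
    have hz' : z ∈ spectrum ℂ X :=
      Matrix.mem_spectrum_iff_isRoot_charpoly.2 (Polynomial.isRoot_of_mem_roots hz)
    exact hcon z hz' (H hX (hball (by rwa [dist_comm, dist_eq_norm])))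
  have gen : ∀ m : Multiset ℂ, (∀ z ∈ m, ε ≤ ‖μ - z‖) →
      ε ^ m.card ≤ ‖(m.map fun z => μ - z).prod‖ := fun m => by
    induction m using Multiset.induction_on with
    | empty => simp
    | cons a m ih =>
      intro h
      rw [Multiset.card_cons, Multiset.map_cons, Multiset.prod_cons, norm_mul, pow_succ']
      exact mul_le_mul (h a (Multiset.mem_cons_self a m))
        (ih fun z hz => h z (Multiset.mem_cons_of_mem hz)) (by positivity) (by positivity)
  calc ε ^ n = ε ^ X.charpoly.roots.card := by rw [hcard]
    _ ≤ _ := gen _ hroot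

/-- The spectrum of a complex matrix is upper hemicontinuous. -/
theorem eventually_spectrum_subset {n : ℕ} {M : Matrix (Fin n) (Fin n) ℂ} {U : Set ℂ}
    (hU : IsOpen U) (hM : spectrum ℂ M ⊆ U) : ∀ᶠ X in 𝓝 M, spectrum ℂ X ⊆ U := by
  let N : Matrix (Fin n) (Fin n) ℂ → ℝ := fun X => ∑ i, ∑ j, ‖X i j‖
  have hN : Continuous N := by
    refine continuous_finsetSum _ fun i _ => continuous_finsetSum _ fun j _ => ?_
    exact (continuous_id.matrix_elem i j).norm
  have hbound (X : Matrix (Fin n) (Fin n) ℂ) (z : ℂ) (hz : z ∈ spectrum ℂ X) : ‖z‖ ≤ N X := by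
    have hz' : Module.End.HasEigenvalue (Matrix.toLin' X) z := by
      rw [Module.End.hasEigenvalue_iff_mem_spectrum, Matrix.spectrum_toLin']
      exact hz
    obtain ⟨i, hi⟩ := eigenvalue_mem_ball hz'
    rw [mem_closedBall_iff_norm] at hi
    calc ‖z‖ ≤ ‖X i i‖ + ‖z - X i i‖ := norm_le_norm_add_norm_sub' _ _
      _ ≤ ‖X i i‖ + ∑ j ∈ Finset.univ.erase i, ‖X i j‖ := by gcongr
      _ = ∑ j, ‖X i j‖ := Finset.add_sum_erase _ (fun j => ‖X i j‖) (Finset.mem_univ i)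
      _ ≤ N X := Finset.single_le_sum (f := fun i => ∑ j, ‖X i j‖)
        (fun i _ => by positivity) (Finset.mem_univ i)
  have hK : IsCompact (Metric.closedBall (0 : ℂ) (N M + 1) \ U) :=
    (isCompact_closedBall _ _).diff hU
  have h1 : ∀ᶠ X in 𝓝 M, ∀ z ∈ Metric.closedBall (0 : ℂ) (N M + 1) \ U, z ∉ spectrum ℂ X := by
    refine hK.eventually_forall_of_forall_eventually fun z hz => ?_
    have hz' : M.charpoly.eval z ≠ 0 := fun h =>
      hz.2 (hM (Matrix.mem_spectrum_iff_isRoot_charpoly.2 h))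
    filter_upwards [((continuous_charpoly_eval n).continuousAt (x := (M, z))).eventually_ne hz']
      with p hp hmem
    exact hp (Matrix.mem_spectrum_iff_isRoot_charpoly.1 hmem)
  filter_upwards [h1, (hN.tendsto M).eventually (gt_mem_nhds (lt_add_one (N M)))] with X hX hlt z hz
  by_contra hzU
  exact hX z ⟨by simpa using (hbound X z hz).trans hlt.le, hzU⟩ hz

/-- If `M` is a limit of matrices in the bundle of `A`, then its eigenvalues correspond to distinct
eigenvalues of `A` in such a way that ranks of powers can only drop. -/
theorem exists_injective_rank_le {n : ℕ} {A M : Matrix (Fin n) (Fin n) ℂ}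
    (h : M ∈ closure (matrixBundle A)) :
    ∃ σ : spectrum ℂ M → spectrum ℂ A, Function.Injective σ ∧
      ∀ (μ : spectrum ℂ M) (k : ℕ), k ≤ n →
        ((M - (μ : ℂ) • (1 : Matrix (Fin n) (Fin n) ℂ)) ^ k).rank ≤
          ((A - (σ μ : ℂ) • (1 : Matrix (Fin n) (Fin n) ℂ)) ^ k).rank := by
  obtain ⟨U, hU, hdisj⟩ := (Matrix.finite_spectrum M).t2_separation
  have hev (μ : spectrum ℂ M) : ∀ᶠ p in 𝓝 (M, (μ : ℂ)), p.2 ∈ U μ ∧ ∀ k ≤ n,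
      ((M - (μ : ℂ) • (1 : Matrix (Fin n) (Fin n) ℂ)) ^ k).rank ≤
        ((p.1 - p.2 • (1 : Matrix (Fin n) (Fin n) ℂ)) ^ k).rank := by
    refine Eventually.and (continuous_snd.continuousAt.eventually
      ((hU μ).2.eventually_mem (hU μ).1)) ?_
    refine (Set.finite_Iic n).eventually_all.2 fun k _ => ?_
    have hc : Continuous fun p : Matrix (Fin n) (Fin n) ℂ × ℂ =>
        (p.1 - p.2 • (1 : Matrix (Fin n) (Fin n) ℂ)) ^ k := by fun_prop
    exact hc.continuousAt.eventually ((isOpen_setOf_le_rank_matrix n _).eventually_mem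
      (Set.mem_ofPred_eq ▸ le_rfl))
  have hev' := eventually_all.2 fun μ : spectrum ℂ M => eventually_exists_mem_spectrum μ.2 (hev μ)
  obtain ⟨X, hX, hXA⟩ := ((mem_closure_iff_frequently.1 h).and_eventually hev').exists.imp
    fun _ h => h.symm
  obtain ⟨φ, hφ⟩ := hXA
  choose f hf hfU hfr using hX
  have hmem (μ : spectrum ℂ M) : φ.symm (f μ) ∈ spectrum ℂ A := by
    by_contra hcon
    rw [notMem_spectrum_iff_rank, ← hφ, φ.apply_symm_apply, ← notMem_spectrum_iff_rank] at hcon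
    exact hcon (hf μ)
  refine ⟨fun μ => ⟨φ.symm (f μ), hmem μ⟩, fun μ ν hμν => ?_, fun μ k hk => ?_⟩
  · have hfe : f μ = f ν := φ.symm.injective (congrArg Subtype.val hμν)
    by_contra hne
    exact Set.disjoint_left.1 (hdisj μ.2 ν.2 fun h => hne (Subtype.ext h)) (hfU μ)
      (hfe ▸ hfU ν)
  · have := hφ (φ.symm (f μ)) k
    rw [φ.apply_symm_apply] at this
    exact (hfr μ k hk).trans this.le

/-- Two matrices each lying in the closure of the bundle of the other have the same bundle. -/
theorem mem_matrixBundle_of_mem_closure {n : ℕ} {A M : Matrix (Fin n) (Fin n) ℂ}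
    (hM : M ∈ closure (matrixBundle A)) (hA : A ∈ closure (matrixBundle M)) :
    M ∈ matrixBundle A := by
  have := Fintype.ofFinite (spectrum ℂ A)
  have := Fintype.ofFinite (spectrum ℂ M)
  obtain ⟨σ, hσ, hσr⟩ := exists_injective_rank_le hM
  obtain ⟨τ, hτ, hτr⟩ := exists_injective_rank_le hA
  have hcard := le_antisymm (Fintype.card_le_of_injective σ hσ) (Fintype.card_le_of_injective τ hτ)
  have hσb := (Fintype.bijective_iff_injective_and_card σ).2 ⟨hσ, hcard⟩
  have hτb := (Fintype.bijective_iff_injective_and_card τ).2 ⟨hτ, hcard.symm⟩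
  refine mem_matrixBundle_of_equiv (Equiv.ofBijective σ hσb).symm fun μ k hk => ?_
  let r (X : Matrix (Fin n) (Fin n) ℂ) (z : ℂ) : ℕ :=
    ((X - z • (1 : Matrix (Fin n) (Fin n) ℂ)) ^ k).rank
  have h1 : ∑ μ : spectrum ℂ M, r M μ ≤ ∑ μ : spectrum ℂ M, r A (σ μ) :=
    Finset.sum_le_sum fun μ _ => hσr μ k hk
  have h2 : ∑ μ : spectrum ℂ A, r A μ ≤ ∑ μ : spectrum ℂ A, r M (τ μ) :=
    Finset.sum_le_sum fun μ _ => hτr μ k hk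
  rw [hτb.sum_comp fun ν : spectrum ℂ M => r M ν] at h2
  rw [hσb.sum_comp fun ν : spectrum ℂ A => r A ν] at h1
  have h3 : ∑ μ : spectrum ℂ M, r M μ = ∑ μ : spectrum ℂ M, r A (σ μ) := by
    rw [hσb.sum_comp fun ν : spectrum ℂ A => r A ν]
    exact le_antisymm h1 h2
  have h4 := (Finset.sum_eq_sum_iff_of_le fun μ _ => hσr μ k hk).1 h3
    ((Equiv.ofBijective σ hσb).symm μ) (Finset.mem_univ _)
  have h5 : σ ((Equiv.ofBijective σ hσb).symm μ) = μ :=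
    (Equiv.ofBijective σ hσb).apply_symm_apply μ
  rw [h5] at h4
  exact h4

open Polynomial in
theorem exists_polynomial_eval_eq_and_derivative_ne_zero {K : Type*} [Field K] {s : Set K}
    (hs : s.Finite) (φ : K → K) :
    ∃ p : K[X], ∀ x ∈ s, p.eval x = φ x ∧ p.derivative.eval x ≠ 0 := by
  classical
  lift s to Finset K using hs
  let L := Lagrange.interpolate s id φ
  let N := Lagrange.nodal s (id : K → K)
  let r := Lagrange.interpolate s id fun x => (1 - L.derivative.eval x) / N.derivative.eval x
  refine ⟨L + N * r, fun x hx => ?_⟩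
  have hx' : x ∈ s := hx
  have hL : L.eval x = φ x := Lagrange.eval_interpolate_at_node φ Function.injective_id.injOn hx'
  have hr : r.eval x = (1 - L.derivative.eval x) / N.derivative.eval x :=
    Lagrange.eval_interpolate_at_node _ Function.injective_id.injOn hx'
  have hN : N.eval x = 0 := Lagrange.eval_nodal_at_node (v := id) hx'
  have hN' : N.derivative.eval x ≠ 0 := by
    have h := Lagrange.eval_nodal_derivative_eval_node_eq (v := (id : K → K)) hx'
    have h2 : eval (id x) (Lagrange.nodal (s.erase x) (id : K → K)) ≠ 0 :=
      Lagrange.eval_nodal_not_at_node fun i hi => (Finset.ne_of_mem_erase hi).symm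
    rw [← h] at h2
    exact h2
  refine ⟨by simp [hL, hN], ?_⟩
  have : (L + N * r).derivative.eval x = 1 := by
    simp only [derivative_add, derivative_mul, eval_add, eval_mul, hN, hr]
    field_simp
    ring
  rw [this]
  exact one_ne_zero

open Polynomial in
theorem rank_pow_aeval_sub_eval {n : ℕ} {K : Type*} [Field K] [IsAlgClosed K]
    (X : Matrix (Fin n) (Fin n) K) (p : K[X]) (μ : K)
    (hinj : ∀ z ∈ spectrum K X, p.eval z = p.eval μ → z = μ) (hder : p.derivative.eval μ ≠ 0)
    (k : ℕ) :
    ((aeval X p - p.eval μ • (1 : Matrix (Fin n) (Fin n) K)) ^ k).rank =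
      ((X - μ • (1 : Matrix (Fin n) (Fin n) K)) ^ k).rank := by
  obtain ⟨q, hq⟩ := X_sub_C_dvd_sub_C_eval (a := μ) (p := p)
  have hqz (z : K) : p.eval z - p.eval μ = (z - μ) * q.eval z := by
    simpa using congrArg (eval z) hq
  have hqμ : q.eval μ ≠ 0 := by
    have := congrArg (fun f : K[X] => f.derivative.eval μ) hq
    simp only [derivative_sub, derivative_C, sub_zero, derivative_mul, derivative_X, one_mul,
      eval_add, eval_mul, eval_sub, eval_X, eval_C, sub_self, zero_mul, add_zero] at this
    rwa [← this]
  have hunit : IsUnit (aeval X q) := by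
    by_contra hcon
    rcases isEmpty_or_nonempty (Fin n) with hn | hn
    · exact hcon (isUnit_of_subsingleton _)
    have h0 : (0 : K) ∈ spectrum K (aeval X q) := spectrum.zero_mem K hcon
    rw [spectrum.map_polynomial_aeval_of_nonempty X q
      (spectrum.nonempty_of_isAlgClosed_of_finiteDimensional K X)] at h0
    obtain ⟨z, hz, hz0⟩ := h0
    have hz0 : q.eval z = 0 := hz0
    have h1 := hinj z hz (by rw [← sub_eq_zero, hqz, hz0, mul_zero])
    exact hqμ (h1 ▸ hz0)
  have hprod : aeval X p - p.eval μ • (1 : Matrix (Fin n) (Fin n) K) =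
      (X - μ • (1 : Matrix (Fin n) (Fin n) K)) * aeval X q := by
    simpa [Algebra.algebraMap_eq_smul_one] using congrArg (aeval X) hq
  have hcomm : Commute (X - μ • (1 : Matrix (Fin n) (Fin n) K)) (aeval X q) := by
    have := (Commute.all (Polynomial.X - C μ) q).map (aeval X)
    simpa [Algebra.algebraMap_eq_smul_one] using this
  rw [hprod, hcomm.mul_pow]
  exact Matrix.rank_mul_eq_left_of_isUnit_det _ _
    ((Matrix.isUnit_iff_isUnit_det _).1 (hunit.pow k))

open Polynomial in
/-- A polynomial which is injective with nonvanishing derivative on the spectrum preserves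
the bundle. -/
theorem aeval_mem_matrixBundle {n : ℕ} (hn : 1 ≤ n) (X : Matrix (Fin n) (Fin n) ℂ) (p : ℂ[X])
    (hinj : Set.InjOn (fun z => p.eval z) (spectrum ℂ X))
    (hder : ∀ z ∈ spectrum ℂ X, p.derivative.eval z ≠ 0) :
    aeval X p ∈ matrixBundle X := by
  have : Nonempty (Fin n) := ⟨⟨0, hn⟩⟩
  have hspec := spectrum.map_polynomial_aeval_of_nonempty X p
    (spectrum.nonempty_of_isAlgClosed_of_finiteDimensional ℂ X)
  refine mem_matrixBundle_of_equiv ((hinj.bijOn_image.equiv _).trans (Equiv.setCongr hspec.symm))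
    fun μ k _ => ?_
  exact rank_pow_aeval_sub_eval X p μ (fun z hz h => hinj hz μ.2 h) (hder μ μ.2) k

open Polynomial in
theorem exists_isOpen_injOn_polynomial {s : Set ℂ} (hs : s.Finite) (p : ℂ[X])
    (hinj : Set.InjOn (fun z => p.eval z) s) (hder : ∀ z ∈ s, p.derivative.eval z ≠ 0) :
    ∃ U, IsOpen U ∧ s ⊆ U ∧ Set.InjOn (fun z => p.eval z) U ∧
      ∀ z ∈ U, p.derivative.eval z ≠ 0 := by
  obtain ⟨t, ht, hti⟩ := hinj.exists_mem_nhdsSet hs.isCompact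
    (fun z _ => p.continuous.continuousAt) (fun z hz => by
      have hd := p.hasStrictDerivAt z
      exact ⟨_, hd.eventually_left_inverse (hf' := hder z hz),
        fun x hx y hy hxy => hx.symm.trans ((congrArg _ hxy).trans hy)⟩)
  obtain ⟨U, hU, hsU, hUt⟩ := mem_nhdsSet_iff_exists.1 ht
  refine ⟨U ∩ {z | p.derivative.eval z ≠ 0}, hU.inter ?_, Set.subset_inter hsU hder,
    hti.mono (Set.inter_subset_left.trans hUt), fun z hz => hz.2⟩
  exact isOpen_ne.preimage p.derivative.continuous

/-- The closure of a bundle is a union of bundles. -/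
theorem matrixBundle_subset_closure {n : ℕ} (hn : 1 ≤ n) {A M : Matrix (Fin n) (Fin n) ℂ}
    (hM : M ∈ closure (matrixBundle A)) : matrixBundle M ⊆ closure (matrixBundle A) := by
  rintro M' ⟨φ, hφ⟩
  have : Nonempty (Fin n) := ⟨⟨0, hn⟩⟩
  obtain ⟨p, hp⟩ := exists_polynomial_eval_eq_and_derivative_ne_zero (Matrix.finite_spectrum M) φ
  have hinj : Set.InjOn (fun z => p.eval z) (spectrum ℂ M) := fun z hz w hw h =>
    φ.injective ((hp z hz).1.symm.trans (h.trans (hp w hw).1))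
  have hder : ∀ z ∈ spectrum ℂ M, p.derivative.eval z ≠ 0 := fun z hz => (hp z hz).2
  have hspec := spectrum.map_polynomial_aeval_of_nonempty M p
    (spectrum.nonempty_of_isAlgClosed_of_finiteDimensional ℂ M)
  obtain ⟨P, Q, hQP, hPQ, hM'⟩ := exists_conj_of_rank_eq (A := Polynomial.aeval M p) (B := M')
    fun ν k => by
      obtain ⟨μ, rfl⟩ := φ.surjective ν
      rw [hφ]
      by_cases hμ : μ ∈ spectrum ℂ M
      · rw [← (hp μ hμ).1]
        exact rank_pow_aeval_sub_eval M p μ (fun z hz h => hinj hz hμ h) (hder μ hμ) k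
      · rw [rank_pow_of_notMem_spectrum hμ, rank_pow_of_notMem_spectrum]
        rw [hspec]
        rintro ⟨z, hz, hzμ⟩
        exact hμ (φ.injective ((hp z hz).1.symm.trans hzμ) ▸ hz)
  obtain ⟨U, hU, hMU, hUinj, hUder⟩ :=
    exists_isOpen_injOn_polynomial (Matrix.finite_spectrum M) p hinj hder
  have hcont : Continuous fun X : Matrix (Fin n) (Fin n) ℂ => P * Polynomial.aeval X p * Q :=
    (continuous_const.matrix_mul (p.continuous_aeval)).matrix_mul continuous_const
  rw [hM']
  refine mem_closure_of_frequently_of_tendsto (f := fun X => P * Polynomial.aeval X p * Q)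
    ?_ (hcont.tendsto M)
  refine ((mem_closure_iff_frequently.1 hM).and_eventually
    (eventually_spectrum_subset hU hMU)).mono fun X ⟨hXA, hXU⟩ => ?_
  rw [← matrixBundle_eq_of_mem hXA, ← matrixBundle_eq_of_mem (aeval_mem_matrixBundle hn X p
    (hUinj.mono hXU) fun z hz => hUder z (hXU hz))]
  refine ⟨Equiv.refl ℂ, fun μ k => ?_⟩
  have hPu : IsUnit P.det := (Matrix.isUnit_iff_isUnit_det _).1 ⟨⟨P, Q, hPQ, hQP⟩, rfl⟩
  have hQu : IsUnit Q.det := (Matrix.isUnit_iff_isUnit_det _).1 ⟨⟨Q, P, hQP, hPQ⟩, rfl⟩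
  have hsub : P * Polynomial.aeval X p * Q - μ • (1 : Matrix (Fin n) (Fin n) ℂ) =
      P * (Polynomial.aeval X p - μ • (1 : Matrix (Fin n) (Fin n) ℂ)) * Q := by
    rw [mul_sub, sub_mul, mul_smul_comm, mul_one, smul_mul_assoc, hPQ]
  have hpow : (P * (Polynomial.aeval X p - μ • (1 : Matrix (Fin n) (Fin n) ℂ)) * Q) ^ k =
      P * (Polynomial.aeval X p - μ • (1 : Matrix (Fin n) (Fin n) ℂ)) ^ k * Q :=
    Units.conj_pow ⟨P, Q, hPQ, hQP⟩ _ k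
  rw [Equiv.refl_apply, hsub, hpow, Matrix.rank_mul_eq_left_of_isUnit_det _ _ hQu,
    Matrix.rank_mul_eq_right_of_isUnit_det _ _ hPu]

/-- The closure of a bundle of matrices is a finite union of pairwise distinct bundles,
the first of which is the bundle itself, and the closures of the others are strictly
contained in the closure of the original bundle. -/
theorem closure_bundle_eq_finite_union (n : ℕ) (hn : 1 ≤ n)
    (A : Matrix (Fin n) (Fin n) ℂ) :
    ∃ (ℓ : ℕ) (hℓ : 1 ≤ ℓ) (As : Fin ℓ → Matrix (Fin n) (Fin n) ℂ),
      As ⟨0, hℓ⟩ = A ∧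
      (∀ i j : Fin ℓ, i ≠ j → matrixBundle (As i) ≠ matrixBundle (As j)) ∧
      (closure (matrixBundle A) = ⋃ i : Fin ℓ, matrixBundle (As i)) ∧
      (∀ i : Fin ℓ, i ≠ ⟨0, hℓ⟩ →
        closure (matrixBundle (As i)) ⊂ closure (matrixBundle A)) := by
  let T : Set (Set (Matrix (Fin n) (Fin n) ℂ)) :=
    {b | b ∈ Set.range (matrixBundle (n := n)) ∧ b ⊆ closure (matrixBundle A) ∧
      b ≠ matrixBundle A}
  have hT : T.Finite := (finite_range_matrixBundle n).subset fun b hb => hb.1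
  have := hT.fintype
  let E := Fintype.equivFin T
  choose R hR using fun b : T => b.2.1
  have hsub (b : T) : matrixBundle (R b) ⊆ closure (matrixBundle A) := by
    rw [hR]; exact b.2.2.1
  have hne (b : T) : matrixBundle (R b) ≠ matrixBundle A := by
    rw [hR]; exact b.2.2.2
  have hinj (b c : T) (h : matrixBundle (R b) = matrixBundle (R c)) : b = c := by
    rw [hR, hR] at h
    exact Subtype.ext h
  refine ⟨Fintype.card T + 1, Nat.le_add_left 1 _, Fin.cons A fun i => R (E.symm i),
    rfl, fun i j hij => ?_, ?_, fun i hi => ?_⟩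
  · induction i using Fin.cases with
    | zero =>
      induction j using Fin.cases with
      | zero => exact absurd rfl hij
      | succ j => exact (hne _).symm
    | succ i =>
      induction j using Fin.cases with
      | zero => exact hne _
      | succ j =>
        intro h
        exact hij (congrArg Fin.succ (E.symm.injective (hinj _ _ h)))
  · refine Set.Subset.antisymm (fun M hM => ?_) (Set.iUnion_subset fun i => ?_)
    · rw [Set.mem_iUnion]
      by_cases h : matrixBundle M = matrixBundle A
      · exact ⟨0, h ▸ mem_matrixBundle_self M⟩
      · let b : T := ⟨matrixBundle M, ⟨M, rfl⟩, matrixBundle_subset_closure hn hM, h⟩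
        refine ⟨(E b).succ, ?_⟩
        rw [Fin.cons_succ, Equiv.symm_apply_apply, hR]
        exact mem_matrixBundle_self M
    · induction i using Fin.cases with
      | zero => exact subset_closure
      | succ i => exact hsub _
  · induction i using Fin.cases with
    | zero => exact absurd rfl hi
    | succ i =>
      rw [Fin.cons_succ]
      refine ⟨closure_minimal (hsub _) isClosed_closure, fun h => ?_⟩
      exact hne _ (matrixBundle_eq_of_mem (mem_matrixBundle_of_mem_closure
        (hsub _ (mem_matrixBundle_self _)) (h (subset_closure (mem_matrixBundle_self A)))))
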